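/- Let X be a complete CAT(-1) metric space and let A, B be closed convex subsets of X with dist(A,B) = D > 0. Then there exists a unique geodesic segment of length D with one endpoint in A and the other in B. -/

import Mathlib

noncomputable section
open Metric Set

/-- `γ` restricted to `[a,b]` is a unit-speed (minimizing) geodesic segment. -/
def IsGeodesicOn {X : Type*} [MetricSpace X] (γ : ℝ → X) (a b : ℝ) : Prop :=
  a ≤ b ∧ ∀ s ∈ Set.Icc a b, ∀ t ∈ Set.Icc a b, dist (γ s) (γ t) = |s - t|

/-- Every pair of points is joined by a geodesic segment. -/
def IsGeodesicSpace (X : Type*) [MetricSpace X] : Prop :=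
  ∀ x y : X, ∃ γ : ℝ → X, IsGeodesicOn γ 0 (dist x y) ∧ γ 0 = x ∧ γ (dist x y) = y

/-- Comparison condition defining CAT spaces with model space `M`:
for any geodesic triangle and a comparison triangle in `M`, distances between
points on two sides issuing from a common vertex are bounded by the
corresponding distances in the comparison triangle. -/
def CATWith (M : Type*) [MetricSpace M] (X : Type*) [MetricSpace X] : Prop :=
  IsGeodesicSpace X ∧
  ∀ (p q r : X) (γ δ : ℝ → X),
    IsGeodesicOn γ 0 (dist p q) → γ 0 = p → γ (dist p q) = q →
    IsGeodesicOn δ 0 (dist p r) → δ 0 = p → δ (dist p r) = r →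
    ∀ (p' q' r' : M) (γ' δ' : ℝ → M),
      dist p' q' = dist p q → dist p' r' = dist p r → dist q' r' = dist q r →
      IsGeodesicOn γ' 0 (dist p q) → γ' 0 = p' → γ' (dist p q) = q' →
      IsGeodesicOn δ' 0 (dist p r) → δ' 0 = p' → δ' (dist p r) = r' →
      ∀ s ∈ Set.Icc (0:ℝ) (dist p q), ∀ t ∈ Set.Icc (0:ℝ) (dist p r),
        dist (γ s) (δ t) ≤ dist (γ' s) (δ' t)

/-- A CAT(-1) space: comparison with the hyperbolic plane of curvature `-1`. -/
def CATMinusOne (X : Type*) [MetricSpace X] : Prop := CATWith UpperHalfPlane X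

/-- A CAT(0) space: comparison with the Euclidean plane. -/
def CATZero (X : Type*) [MetricSpace X] : Prop := CATWith (EuclideanSpace ℝ (Fin 2)) X

/-- A subset is (geodesically) convex if it contains every geodesic segment
between any two of its points. -/
def GConvex {X : Type*} [MetricSpace X] (A : Set X) : Prop :=
  ∀ (γ : ℝ → X) (a b : ℝ), IsGeodesicOn γ a b → γ a ∈ A → γ b ∈ A →
    ∀ t ∈ Set.Icc a b, γ t ∈ A

/-- Distance between two subsets: the infimum of distances between their points. -/
def setDist {X : Type*} [MetricSpace X] (A B : Set X) : ℝ :=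
  sInf ((fun p : X × X => dist p.1 p.2) '' A ×ˢ B)

end

noncomputable section

/-- The point of the upper half plane obtained from `y * I` by the rotation about `I` with
parameters `c`, `s`. -/
def rotatedPoint (c s y : ℝ) (h : c ^ 2 + s ^ 2 = 1) (hy : 0 < y) : UpperHalfPlane :=
  ⟨⟨s * c * (1 - y ^ 2) / (c ^ 2 + s ^ 2 * y ^ 2), y / (c ^ 2 + s ^ 2 * y ^ 2)⟩, by
    have : 0 < c ^ 2 + s ^ 2 * y ^ 2 := by
      rcases eq_or_ne s 0 with rfl | hs
      · nlinarith
      · positivity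
    exact div_pos hy this⟩

lemma rotatedPoint_denom_pos {c s y : ℝ} (h : c ^ 2 + s ^ 2 = 1) (hy : 0 < y) :
    0 < c ^ 2 + s ^ 2 * y ^ 2 := by
  rcases eq_or_ne s 0 with rfl | hs
  · nlinarith
  · positivity

lemma cosh_dist_rotatedPoint {c s u v : ℝ} (h : c ^ 2 + s ^ 2 = 1) (hu : 0 < u) (hv : 0 < v) :
    Real.cosh (dist (rotatedPoint c s u h hu) (rotatedPoint c s v h hv)) =
      (u ^ 2 + v ^ 2) / (2 * u * v) := by
  have hN := rotatedPoint_denom_pos h hu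
  have hM := rotatedPoint_denom_pos h hv
  rw [UpperHalfPlane.cosh_dist']
  simp only [rotatedPoint, UpperHalfPlane.re, UpperHalfPlane.im]
  obtain ⟨N, hNe⟩ : ∃ N, N = c ^ 2 + s ^ 2 * u ^ 2 := ⟨_, rfl⟩
  obtain ⟨M, hMe⟩ : ∃ M, M = c ^ 2 + s ^ 2 * v ^ 2 := ⟨_, rfl⟩
  rw [← hNe, ← hMe]
  rw [← hNe] at hN
  rw [← hMe] at hM
  have key : s * c * (1 - u ^ 2) / N - s * c * (1 - v ^ 2) / M =
      s * c * (v ^ 2 - u ^ 2) / (N * M) := by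
    field_simp
    rw [hNe, hMe]
    linear_combination (s * c * (v ^ 2 - u ^ 2)) * h
  rw [key]
  field_simp
  rw [hNe, hMe]
  have hc : c ^ 2 = 1 - s ^ 2 := by linarith
  rw [hc]
  ring

lemma cosh_dist_axis_rotatedPoint {c s u v : ℝ} (h : c ^ 2 + s ^ 2 = 1) (hu : 0 < u)
    (hv : 0 < v) :
    Real.cosh (dist (rotatedPoint 1 0 u (by norm_num) hu) (rotatedPoint c s v h hv)) =
      (c ^ 2 * (u ^ 2 + v ^ 2) + s ^ 2 * (1 + u ^ 2 * v ^ 2)) / (2 * u * v) := by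
  have hM := rotatedPoint_denom_pos h hv
  rw [UpperHalfPlane.cosh_dist']
  simp only [rotatedPoint, UpperHalfPlane.re, UpperHalfPlane.im]
  field_simp
  ring_nf
  have hc : c ^ 2 = 1 - s ^ 2 := by linarith
  have hc' : c ^ 4 = (1 - s ^ 2) ^ 2 := by rw [← hc]; ring
  simp only [hc, hc']
  ring

/-- The unit-speed hyperbolic geodesic issuing from `I` in the direction given by `c`, `s`. -/
def hyperbolicRay (c s : ℝ) (h : c ^ 2 + s ^ 2 = 1) (t : ℝ) : UpperHalfPlane :=
  rotatedPoint c s (Real.exp t) h (Real.exp_pos t)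

lemma hyperbolicRay_zero {c s : ℝ} (h : c ^ 2 + s ^ 2 = 1) :
    hyperbolicRay c s h 0 = UpperHalfPlane.I := by
  apply UpperHalfPlane.ext
  apply Complex.ext <;> simp [hyperbolicRay, rotatedPoint, h]

lemma dist_hyperbolicRay {c s : ℝ} (h : c ^ 2 + s ^ 2 = 1) (t t' : ℝ) :
    dist (hyperbolicRay c s h t) (hyperbolicRay c s h t') = |t - t'| := by
  rw [← abs_of_nonneg (a := dist _ _) dist_nonneg]
  apply le_antisymm <;>
  · rw [← Real.cosh_le_cosh, hyperbolicRay, hyperbolicRay, cosh_dist_rotatedPoint,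
      Real.cosh_eq (t - t'), Real.exp_sub, neg_sub, Real.exp_sub]
    apply le_of_eq
    field_simp

lemma cosh_dist_axis_hyperbolicRay {c s : ℝ} (h : c ^ 2 + s ^ 2 = 1) (t t' : ℝ) :
    Real.cosh (dist (hyperbolicRay 1 0 (by norm_num) t) (hyperbolicRay c s h t')) =
      c ^ 2 * Real.cosh (t - t') + s ^ 2 * Real.cosh (t + t') := by
  rw [hyperbolicRay, hyperbolicRay, cosh_dist_axis_rotatedPoint, Real.cosh_eq, Real.cosh_eq,
    neg_add, neg_sub]
  simp only [Real.exp_sub, Real.exp_add, Real.exp_neg]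
  field_simp
  ring

lemma isGeodesicOn_hyperbolicRay {c s : ℝ} (h : c ^ 2 + s ^ 2 = 1) {l : ℝ} (hl : 0 ≤ l) :
    IsGeodesicOn (hyperbolicRay c s h) 0 l :=
  ⟨hl, fun t _ t' _ => dist_hyperbolicRay h t t'⟩

lemma sinh_mul_cosh_add (l s d : ℝ) :
    Real.sinh (l - s) * Real.cosh d + Real.sinh s * Real.cosh (l + d) =
      Real.sinh l * Real.cosh (s + d) := by
  simp only [Real.sinh_sub, Real.cosh_add]
  ring

/-- Parameters of the comparison triangle with side lengths `l`, `m`, `n`. -/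
lemma exists_comparison_angle {l m n : ℝ} (hl : 0 ≤ l) (hm : 0 ≤ m) (h₁ : |l - m| ≤ n)
    (h₂ : n ≤ l + m) :
    ∃ c s : ℝ, c ^ 2 + s ^ 2 = 1 ∧
      c ^ 2 * Real.cosh (l - m) + s ^ 2 * Real.cosh (l + m) = Real.cosh n := by
  have hn : 0 ≤ n := (abs_nonneg _).trans h₁
  have k₁ : Real.cosh (l - m) ≤ Real.cosh n := by
    rw [Real.cosh_le_cosh, abs_of_nonneg hn]; exact h₁
  have k₂ : Real.cosh n ≤ Real.cosh (l + m) := by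
    rw [Real.cosh_le_cosh, abs_of_nonneg hn, abs_of_nonneg (by positivity)]; exact h₂
  obtain ⟨x, y, hx, hy, hxy, e⟩ : Real.cosh n ∈
      segment ℝ (Real.cosh (l - m)) (Real.cosh (l + m)) := by
    rw [segment_eq_Icc (k₁.trans k₂)]
    exact ⟨k₁, k₂⟩
  refine ⟨√x, √y, ?_, ?_⟩ <;> simp only [Real.sq_sqrt hx, Real.sq_sqrt hy]
  · exact hxy
  · simpa using e

lemma GConvex.mem_of_isGeodesicOn {X : Type*} [MetricSpace X] {A : Set X} (hA : GConvex A)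
    {γ : ℝ → X} {a b : ℝ} {p q : X} (h : IsGeodesicOn γ a b) (hp : γ a = p) (hq : γ b = q)
    (hpA : p ∈ A) (hqA : q ∈ A) {t : ℝ} (ht : t ∈ Set.Icc a b) : γ t ∈ A :=
  hA γ a b h (hp ▸ hpA) (hq ▸ hqA) t ht

section CATMinusOne

variable {X : Type*} [MetricSpace X]

/-- Hyperbolic Stewart inequality in CAT(-1) spaces. -/
lemma CATMinusOne.sinh_mul_cosh_dist_le (hX : CATMinusOne X) {p q : X} (r : X) {γ : ℝ → X}
    (hγ : IsGeodesicOn γ 0 (dist p q)) (h₀ : γ 0 = p) (h₁ : γ (dist p q) = q)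
    {s : ℝ} (hs : s ∈ Set.Icc 0 (dist p q)) :
    Real.sinh (dist p q) * Real.cosh (dist (γ s) r) ≤
      Real.sinh (dist p q - s) * Real.cosh (dist p r) +
        Real.sinh s * Real.cosh (dist q r) := by
  obtain ⟨δ, hδ, hδ₀, hδ₁⟩ := hX.1 p r
  obtain ⟨c, k, hck, e⟩ := exists_comparison_angle (l := dist p q) (m := dist p r)
    (n := dist q r) dist_nonneg dist_nonneg
    (by rw [dist_comm p q, dist_comm p r]; exact abs_dist_sub_le q r p)
    (by rw [dist_comm p q]; exact dist_triangle q p r)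
  have hone : (1 : ℝ) ^ 2 + 0 ^ 2 = 1 := by norm_num
  have hqr : dist (hyperbolicRay 1 0 hone (dist p q)) (hyperbolicRay c k hck (dist p r)) =
      dist q r := by
    have h := cosh_dist_axis_hyperbolicRay hck (dist p q) (dist p r)
    rw [e] at h
    exact Real.cosh_injOn dist_nonneg dist_nonneg h
  have hray : ∀ {c k : ℝ} (h : c ^ 2 + k ^ 2 = 1) (l : ℝ), 0 ≤ l →
      dist UpperHalfPlane.I (hyperbolicRay c k h l) = l := by
    intro c k h l hl
    rw [← hyperbolicRay_zero h, dist_hyperbolicRay, zero_sub, abs_neg, abs_of_nonneg hl]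
  have key := hX.2 p q r γ δ hγ h₀ h₁ hδ hδ₀ hδ₁ UpperHalfPlane.I _ _ _ _
    (hray hone _ dist_nonneg) (hray hck _ dist_nonneg) hqr
    (isGeodesicOn_hyperbolicRay hone dist_nonneg) (hyperbolicRay_zero hone) rfl
    (isGeodesicOn_hyperbolicRay hck dist_nonneg) (hyperbolicRay_zero hck) rfl
    s hs (dist p r) ⟨dist_nonneg, le_rfl⟩
  rw [hδ₁] at key
  have key' : Real.cosh (dist (γ s) r) ≤
      c ^ 2 * Real.cosh (s - dist p r) + k ^ 2 * Real.cosh (s + dist p r) := by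
    rw [← cosh_dist_axis_hyperbolicRay hck, Real.cosh_le_cosh, abs_of_nonneg dist_nonneg,
      abs_of_nonneg dist_nonneg]
    exact key
  refine (mul_le_mul_of_nonneg_left key' (Real.sinh_nonneg_iff.2 dist_nonneg)).trans
    (le_of_eq ?_)
  have e₁ := sinh_mul_cosh_add (dist p q) s (dist p r)
  have e₂ := sinh_mul_cosh_add (dist p q) s (-dist p r)
  rw [Real.cosh_neg, ← sub_eq_add_neg, ← sub_eq_add_neg] at e₂
  linear_combination (Real.sinh s) * e - k ^ 2 * e₁ - c ^ 2 * e₂ +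
    Real.sinh (dist p q - s) * Real.cosh (dist p r) * hck

lemma CATMinusOne.exists_midpoint (hX : CATMinusOne X) (p q : X) :
    ∃ m : X, ∀ r, 2 * Real.cosh (dist p q / 2) * Real.cosh (dist m r) ≤
      Real.cosh (dist p r) + Real.cosh (dist q r) := by
  rcases eq_or_ne p q with rfl | hpq
  · refine ⟨p, fun r => ?_⟩
    simp [two_mul]
  obtain ⟨γ, hγ, h₀, h₁⟩ := hX.1 p q
  have hd : 0 < dist p q := dist_pos.2 hpq
  refine ⟨γ (dist p q / 2), fun r => ?_⟩
  have h := hX.sinh_mul_cosh_dist_le r hγ h₀ h₁ (s := dist p q / 2)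
    ⟨by positivity, by linarith⟩
  have e : Real.sinh (dist p q) = 2 * Real.sinh (dist p q / 2) * Real.cosh (dist p q / 2) := by
    rw [← Real.sinh_two_mul]; congr 1; ring
  rw [e, sub_half] at h
  have hpos : 0 < Real.sinh (dist p q / 2) := Real.sinh_pos_iff.2 (by positivity)
  refine le_of_mul_le_mul_left ?_ hpos
  linarith

/-- Four point inequality in CAT(-1) spaces: sides against diagonals. -/
lemma CATMinusOne.four_mul_cosh_mul_cosh_le (hX : CATMinusOne X) (x y z w : X) :
    4 * (Real.cosh (dist x z / 2) * Real.cosh (dist y w / 2)) ≤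
      Real.cosh (dist x y) + Real.cosh (dist y z) + Real.cosh (dist z w) +
        Real.cosh (dist w x) := by
  obtain ⟨m, hm⟩ := hX.exists_midpoint x z
  obtain ⟨n, hn⟩ := hX.exists_midpoint y w
  have h₁ := hm y
  have h₂ := hm w
  have h₃ := hn m
  rw [dist_comm y m, dist_comm w m] at h₃
  rw [dist_comm y z, dist_comm w x]
  have h₀ : 0 < Real.cosh (dist x z / 2) := Real.cosh_pos _
  have h₄ := mul_le_mul_of_nonneg_left h₃ h₀.le
  have h₅ : Real.cosh (dist x z / 2) * Real.cosh (dist y w / 2) ≤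
      Real.cosh (dist x z / 2) * Real.cosh (dist y w / 2) * Real.cosh (dist n m) :=
    le_mul_of_one_le_right (by positivity) (Real.one_le_cosh _)
  rw [dist_comm z y] at *
  linarith

/-- Approximate Pythagorean inequality at an almost nearest point of a convex set. -/
lemma CATMinusOne.mul_cosh_le_cosh_dist (hX : CATMinusOne X) {A : Set X} (hA : GConvex A)
    {b a₁ a₂ : X} (h₁ : a₁ ∈ A) (h₂ : a₂ ∈ A) {C κ t : ℝ} (hC : 0 < C)
    (hmin : ∀ a ∈ A, C ≤ Real.cosh (dist a b)) (ht : 0 < t) (hta : t ≤ dist a₁ a₂)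
    (htκ : C * Real.sinh t ≤ κ / 2)
    (hE : Real.cosh (dist a₁ b) ≤ C + κ / 2 * Real.sinh t) :
    (C - κ) * Real.cosh (dist a₁ a₂) ≤ Real.cosh (dist a₂ b) := by
  obtain ⟨γ, hγ, hγ₀, hγ₁⟩ := hX.1 a₁ a₂
  have hts : t ∈ Set.Icc 0 (dist a₁ a₂) := ⟨ht.le, hta⟩
  have h := hX.sinh_mul_cosh_dist_le b hγ hγ₀ hγ₁ hts
  have hm := hmin _ (hA.mem_of_isGeodesicOn hγ hγ₀ hγ₁ h₁ h₂ hts)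
  set α := dist a₁ a₂
  have hα : 0 ≤ Real.sinh α := Real.sinh_nonneg_iff.2 dist_nonneg
  have hαt : 0 ≤ Real.sinh (α - t) := Real.sinh_nonneg_iff.2 (by linarith)
  have hst : 0 < Real.sinh t := Real.sinh_pos_iff.2 ht
  have hκ : 0 < κ := by nlinarith
  have hcα : Real.sinh α ≤ Real.cosh α := (Real.sinh_lt_cosh α).le
  have hcαt : Real.sinh (α - t) ≤ Real.cosh α :=
    (Real.sinh_le_sinh.2 (by linarith)).trans hcα
  have hct : Real.cosh t - 1 ≤ Real.sinh t ^ 2 := by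
    nlinarith [Real.cosh_sq t, Real.one_le_cosh t]
  have hct' : 0 ≤ Real.cosh t - 1 := by linarith [Real.one_le_cosh t]
  have e := Real.sinh_sub α t
  have i₁ : C * Real.sinh α ≤ Real.sinh α * Real.cosh (dist (γ t) b) := by
    nlinarith
  have i₂ : Real.sinh (α - t) * Real.cosh (dist a₁ b) ≤
      C * Real.sinh (α - t) + κ / 2 * Real.sinh t * Real.cosh α := by
    have := mul_le_mul_of_nonneg_left hE hαt
    have := mul_le_mul_of_nonneg_left hcαt (by positivity : 0 ≤ κ / 2 * Real.sinh t)
    linarith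
  have i₃ : C * (Real.sinh α * (Real.cosh t - 1)) ≤ κ / 2 * Real.sinh t * Real.cosh α := by
    have j₁ : C * (Real.cosh t - 1) ≤ κ / 2 * Real.sinh t := by nlinarith
    have j₂ := mul_le_mul_of_nonneg_left hcα (mul_nonneg hC.le hct')
    have j₃ := mul_le_mul_of_nonneg_right j₁ (Real.cosh_pos α).le
    linarith
  refine le_of_mul_le_mul_left ?_ hst
  rw [e] at i₂ h
  linarith

lemma CATMinusOne.dist_lt_of_dist_le (hX : CATMinusOne X) {A B : Set X} (hA : GConvex A)
    {C κ t η : ℝ} (hC : 1 < C) (hmin : ∀ a ∈ A, ∀ b ∈ B, C ≤ Real.cosh (dist a b))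
    (ht : 0 < t) (htη : t ≤ η) (htκ : C * Real.sinh t ≤ κ / 2) (hκ₁ : κ ≤ C - 1)
    (hκ : κ * (Real.cosh η + 1) < (C - 1) * (Real.cosh η - 1)) {a₁ a₂ b₁ b₂ : X}
    (ha₁ : a₁ ∈ A) (ha₂ : a₂ ∈ A) (hb₁ : b₁ ∈ B) (hb₂ : b₂ ∈ B)
    (h₁ : Real.cosh (dist a₁ b₁) ≤ C + κ / 2 * Real.sinh t)
    (h₂ : Real.cosh (dist a₂ b₂) ≤ C + κ / 2 * Real.sinh t)
    (h₁' : Real.cosh (dist a₁ b₁) ≤ C + κ) (h₂' : Real.cosh (dist a₂ b₂) ≤ C + κ)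
    (hle : dist b₁ b₂ ≤ dist a₁ a₂) : dist a₁ a₂ < η := by
  by_contra! hη
  have hC₀ : 0 < C := by linarith
  have d₁ := hX.mul_cosh_le_cosh_dist hA ha₁ ha₂ hC₀ (fun a ha => hmin a ha b₁ hb₁) ht
    (htη.trans hη) htκ h₁
  have d₂ := hX.mul_cosh_le_cosh_dist hA ha₂ ha₁ hC₀ (fun a ha => hmin a ha b₂ hb₂) ht
    ((htη.trans hη).trans_eq (dist_comm _ _)) htκ h₂
  rw [dist_comm a₂ a₁] at d₂
  have q := hX.four_mul_cosh_mul_cosh_le a₁ a₂ b₂ b₁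
  have hβ : Real.cosh (dist b₂ b₁) ≤ Real.cosh (dist a₁ a₂) := by
    rw [Real.cosh_le_cosh, abs_of_nonneg dist_nonneg, abs_of_nonneg dist_nonneg, dist_comm]
    exact hle
  have hα : Real.cosh η ≤ Real.cosh (dist a₁ a₂) := by
    rw [Real.cosh_le_cosh, abs_of_nonneg dist_nonneg, abs_of_nonneg (ht.le.trans htη)]
    exact hη
  rw [dist_comm b₁ a₁] at q
  have e : ∀ x, Real.cosh x = 2 * Real.cosh (x / 2) ^ 2 - 1 := fun x => by
    have := Real.cosh_two_mul (x / 2)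
    rw [mul_div_cancel₀ x two_ne_zero] at this
    linarith [Real.cosh_sq (x / 2)]
  rw [e (dist a₂ b₁)] at d₁
  rw [e (dist a₁ b₂)] at d₂
  set u := Real.cosh (dist a₂ b₁ / 2)
  set v := Real.cosh (dist a₁ b₂ / 2)
  have hu : 0 < u := Real.cosh_pos _
  have hv : 0 < v := Real.cosh_pos _
  have huv : (C - κ) * Real.cosh (dist a₁ a₂) + 1 ≤ 2 * (v * u) := by
    rcases le_total u v with h | h <;> nlinarith
  nlinarith

lemma CATMinusOne.exists_dist_lt (hX : CATMinusOne X) {A B : Set X} (hA : GConvex A)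
    (hB : GConvex B) {D : ℝ} (hD : 0 < D) (hmin : ∀ a ∈ A, ∀ b ∈ B, D ≤ dist a b)
    {η : ℝ} (hη : 0 < η) :
    ∃ ε > 0, ∀ a₁ ∈ A, ∀ a₂ ∈ A, ∀ b₁ ∈ B, ∀ b₂ ∈ B, dist a₁ b₁ ≤ D + ε →
      dist a₂ b₂ ≤ D + ε → dist a₁ a₂ < η ∧ dist b₁ b₂ < η := by
  have hC : 1 < Real.cosh D := Real.one_lt_cosh.2 hD.ne'
  have hH : 1 < Real.cosh η := Real.one_lt_cosh.2 hη.ne'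
  have hmin' : ∀ a ∈ A, ∀ b ∈ B, Real.cosh D ≤ Real.cosh (dist a b) := fun a ha b hb => by
    rw [Real.cosh_le_cosh, abs_of_nonneg hD.le, abs_of_nonneg dist_nonneg]
    exact hmin a ha b hb
  set C := Real.cosh D with hCdef
  obtain ⟨κ, hκ₀, hκ⟩ : ∃ κ > 0, κ * (Real.cosh η + 1) < (C - 1) * (Real.cosh η - 1) := by
    refine ⟨(C - 1) * (Real.cosh η - 1) / (2 * (Real.cosh η + 1)), ?_, ?_⟩
    · have := mul_pos (sub_pos.2 hC) (sub_pos.2 hH)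
      positivity
    · have := mul_pos (sub_pos.2 hC) (sub_pos.2 hH)
      field_simp
      linarith
  have hκ₁ : κ ≤ C - 1 := by nlinarith
  obtain ⟨t, ht, htη, htκ⟩ : ∃ t > 0, t ≤ η ∧ C * Real.sinh t ≤ κ / 2 := by
    have hC₀ : 0 < C := by linarith
    refine ⟨min η (Real.arsinh (κ / (2 * C))), lt_min hη (Real.arsinh_pos_iff.2 (by positivity)),
      min_le_left _ _, ?_⟩
    have : Real.sinh (min η (Real.arsinh (κ / (2 * C)))) ≤ κ / (2 * C) := by
      conv_rhs => rw [← Real.sinh_arsinh (κ / (2 * C))]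
      exact Real.sinh_le_sinh.2 (min_le_right _ _)
    calc _ ≤ C * (κ / (2 * C)) := by gcongr
      _ = κ / 2 := by field_simp
  have hst : 0 < Real.sinh t := Real.sinh_pos_iff.2 ht
  obtain ⟨ε, hε, hεC⟩ : ∃ ε > 0, Real.cosh (D + ε) < C + min κ (κ / 2 * Real.sinh t) := by
    have hcont : Filter.Tendsto (fun ε => Real.cosh (D + ε)) (nhdsWithin 0 (Set.Ioi 0))
        (nhds C) := by
      have : Continuous fun ε => Real.cosh (D + ε) := by fun_prop
      simpa [hCdef] using (this.tendsto 0).mono_left nhdsWithin_le_nhds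
    have hev := hcont.eventually_lt_const
      (show C < C + min κ (κ / 2 * Real.sinh t) from lt_add_of_pos_right _ (by positivity))
    obtain ⟨ε, h₁, h₂⟩ := (hev.and self_mem_nhdsWithin).exists
    exact ⟨ε, h₂, h₁⟩
  refine ⟨ε, hε, fun a₁ ha₁ a₂ ha₂ b₁ hb₁ b₂ hb₂ h₁ h₂ => ?_⟩
  have bound : ∀ {x y : X}, dist x y ≤ D + ε → Real.cosh (dist x y) ≤ C + κ / 2 * Real.sinh t ∧
      Real.cosh (dist x y) ≤ C + κ := fun {x y} h => by
    have : Real.cosh (dist x y) ≤ Real.cosh (D + ε) := by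
      rw [Real.cosh_le_cosh, abs_of_nonneg dist_nonneg, abs_of_nonneg (by positivity)]
      exact h
    constructor
    · linarith [min_le_right κ (κ / 2 * Real.sinh t)]
    · linarith [min_le_left κ (κ / 2 * Real.sinh t)]
  rcases le_total (dist b₁ b₂) (dist a₁ a₂) with h | h
  · have := hX.dist_lt_of_dist_le hA hC hmin' ht htη htκ hκ₁ hκ ha₁ ha₂ hb₁ hb₂
      (bound h₁).1 (bound h₂).1 (bound h₁).2 (bound h₂).2 h
    exact ⟨this, h.trans_lt this⟩
  · rw [dist_comm] at h₁ h₂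
    have := hX.dist_lt_of_dist_le hB hC
      (fun b hb a ha => (hmin' a ha b hb).trans_eq (by rw [dist_comm])) ht htη htκ hκ₁ hκ
      hb₁ hb₂ ha₁ ha₂ (bound h₁).1 (bound h₂).1 (bound h₁).2 (bound h₂).2 h
    exact ⟨h.trans_lt this, this⟩

lemma CATMinusOne.geodesic_unique (hX : CATMinusOne X) {γ δ : ℝ → X} {l : ℝ}
    (hγ : IsGeodesicOn γ 0 l) (hδ : IsGeodesicOn δ 0 l) (h₀ : γ 0 = δ 0) (h₁ : γ l = δ l)
    {s : ℝ} (hs : s ∈ Set.Icc 0 l) : γ s = δ s := by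
  have hl : 0 ≤ l := hγ.1
  have hd : dist (γ 0) (γ l) = l := by
    rw [hγ.2 0 ⟨le_rfl, hl⟩ l ⟨hl, le_rfl⟩, zero_sub, abs_neg, abs_of_nonneg hl]
  rcases hl.eq_or_lt with rfl | hlpos
  · obtain rfl : s = 0 := le_antisymm hs.2 hs.1
    exact h₀
  have h := hX.sinh_mul_cosh_dist_le (p := γ 0) (q := γ l) (γ := γ) (δ s) (by rwa [hd]) rfl
    (by rw [hd]) (s := s) (by rwa [hd])
  rw [hd, h₀, h₁, hδ.2 0 ⟨le_rfl, hl⟩ s hs, hδ.2 l ⟨hl, le_rfl⟩ s hs, zero_sub, abs_neg,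
    Real.cosh_abs, Real.cosh_abs, mul_comm (Real.sinh s), ← Real.sinh_add,
    sub_add_cancel] at h
  have hc : Real.cosh (dist (γ s) (δ s)) ≤ 1 :=
    le_of_mul_le_mul_left (by linarith) (Real.sinh_pos_iff.2 hlpos)
  by_contra hne
  exact absurd hc (not_le.2 (Real.one_lt_cosh.2 (dist_pos.2 hne).ne'))

end CATMinusOne

lemma setDist_le_dist {X : Type*} [MetricSpace X] {A B : Set X} {a b : X} (ha : a ∈ A)
    (hb : b ∈ B) : setDist A B ≤ dist a b :=
  csInf_le ⟨0, by rintro _ ⟨p, -, rfl⟩; exact dist_nonneg⟩ ⟨(a, b), ⟨ha, hb⟩, rfl⟩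

lemma exists_dist_lt_of_setDist_lt {X : Type*} [MetricSpace X] {A B : Set X}
    (h : 0 < setDist A B) {r : ℝ} (hr : setDist A B < r) : ∃ a ∈ A, ∃ b ∈ B, dist a b < r := by
  have hne : ((fun p : X × X => dist p.1 p.2) '' A ×ˢ B).Nonempty := by
    by_contra hne
    rw [Set.not_nonempty_iff_eq_empty] at hne
    rw [setDist, hne, Real.sInf_empty] at h
    exact h.false
  obtain ⟨_, ⟨p, hp, rfl⟩, hlt⟩ := exists_lt_of_csInf_lt hne hr
  exact ⟨p.1, hp.1, p.2, hp.2, hlt⟩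

/-- Two closed convex sets at positive distance in a complete CAT(-1) space realize their
distance. -/
lemma CATMinusOne.exists_dist_eq_setDist {X : Type*} [MetricSpace X] [CompleteSpace X]
    (hX : CATMinusOne X) {A B : Set X} (hA : IsClosed A) (hB : IsClosed B)
    (hAc : GConvex A) (hBc : GConvex B) (hpos : 0 < setDist A B) :
    ∃ a ∈ A, ∃ b ∈ B, dist a b = setDist A B := by
  have hex : ∀ n : ℕ, ∃ p : X × X, p.1 ∈ A ∧ p.2 ∈ B ∧
      dist p.1 p.2 < setDist A B + 1 / ((n : ℝ) + 1) := fun n => by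
    obtain ⟨a, ha, b, hb, h⟩ := exists_dist_lt_of_setDist_lt hpos
      (r := setDist A B + 1 / ((n : ℝ) + 1)) (lt_add_of_pos_right _ (by positivity))
    exact ⟨(a, b), ha, hb, h⟩
  choose p hpA hpB hp using hex
  have hcau : CauchySeq p := by
    refine Metric.cauchySeq_iff.2 fun η hη => ?_
    obtain ⟨ε, hε, h⟩ := hX.exists_dist_lt hAc hBc hpos
      (fun a ha b hb => setDist_le_dist ha hb) hη
    obtain ⟨N, hN⟩ := exists_nat_one_div_lt hε
    have hle : ∀ n ≥ N, dist (p n).1 (p n).2 ≤ setDist A B + ε := fun n hn => by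
      have : 1 / ((n : ℝ) + 1) ≤ 1 / ((N : ℝ) + 1) :=
        one_div_le_one_div_of_le (by positivity) (by gcongr)
      linarith [hp n]
    refine ⟨N, fun m hm n hn => ?_⟩
    have := h _ (hpA m) _ (hpA n) _ (hpB m) _ (hpB n) (hle m hm) (hle n hn)
    exact max_lt this.1 this.2
  obtain ⟨q, hq⟩ := cauchySeq_tendsto_of_complete hcau
  have hq₁ : q.1 ∈ A := hA.mem_of_tendsto ((continuous_fst.tendsto q).comp hq)
    (Filter.Eventually.of_forall hpA)
  have hq₂ : q.2 ∈ B := hB.mem_of_tendsto ((continuous_snd.tendsto q).comp hq)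
    (Filter.Eventually.of_forall hpB)
  refine ⟨q.1, hq₁, q.2, hq₂, le_antisymm ?_ (setDist_le_dist hq₁ hq₂)⟩
  have hlim : Filter.Tendsto (fun n : ℕ => setDist A B + 1 / ((n : ℝ) + 1)) Filter.atTop
      (nhds (setDist A B)) := by
    simpa using (tendsto_one_div_add_atTop_nhds_zero_nat (𝕜 := ℝ)).const_add (setDist A B)
  exact le_of_tendsto_of_tendsto' ((continuous_dist.tendsto q).comp hq) hlim
    fun n => (hp n).le

end

/-- In a complete CAT(-1) space, two closed convex subsets at
positive distance `D` are joined by a unique geodesic segment of length `D`. -/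
theorem statement0 {X : Type*} [MetricSpace X] [CompleteSpace X]
    (hX : CATMinusOne X) (A B : Set X) (hA : IsClosed A) (hB : IsClosed B)
    (hAc : GConvex A) (hBc : GConvex B) (D : ℝ) (hD : setDist A B = D) (hDpos : 0 < D) :
    ∃! S : Set X, ∃ γ : ℝ → X, IsGeodesicOn γ 0 D ∧ γ 0 ∈ A ∧ γ D ∈ B ∧
      S = γ '' Set.Icc 0 D := by
  subst hD
  obtain ⟨a, ha, b, hb, hab⟩ := hX.exists_dist_eq_setDist hA hB hAc hBc hDpos
  obtain ⟨γ, hγ, h₀, h₁⟩ := hX.1 a b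
  rw [hab] at hγ h₁
  refine ⟨γ '' Set.Icc 0 (setDist A B), ⟨γ, hγ, h₀ ▸ ha, h₁ ▸ hb, rfl⟩, ?_⟩
  rintro _ ⟨δ, hδ, hδA, hδB, rfl⟩
  have hδd : dist (δ 0) (δ (setDist A B)) = setDist A B := by
    rw [hδ.2 0 ⟨le_rfl, hDpos.le⟩ _ ⟨hDpos.le, le_rfl⟩, zero_sub, abs_neg,
      abs_of_pos hDpos]
  have hclose : ∀ η > 0, dist (δ 0) a < η ∧ dist (δ (setDist A B)) b < η := fun η hη => by
    obtain ⟨ε, hε, h⟩ := hX.exists_dist_lt hAc hBc hDpos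
      (fun a ha b hb => setDist_le_dist ha hb) hη
    exact h _ hδA _ ha _ hδB _ hb (by linarith) (by linarith)
  have e₀ : δ 0 = a := by
    by_contra hne
    exact (hclose _ (dist_pos.2 hne)).1.false
  have e₁ : δ (setDist A B) = b := by
    by_contra hne
    exact (hclose _ (dist_pos.2 hne)).2.false
  exact Set.image_congr fun s hs =>
    hX.geodesic_unique hδ hγ (e₀.trans h₀.symm) (e₁.trans h₁.symm) hs
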